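/- Let α = (1+√5)/2 be the positive root of x²−x−1 and let β = (125/4)^{1/4} be the positive root of 4x⁴−125. Let H(n) = H(Res(f₀+f₁x+f₂x², g)) where g is generic of degree n. Then there exist constants c₁, c₂ > 0 and N such that for all n > N: c₁ · αⁿ/n^{3/2} ≤ β·αⁿ/√(nπ) − H(n) ≤ c₂ · αⁿ/n^{3/2}. -/

import Mathlib

noncomputable section

open MvPolynomial

/-- The generic Sylvester matrix of a degree-`m` polynomial `f = f₀ + ⋯ + f_m xᵐ` and a
degree-`n` polynomial `g = g₀ + ⋯ + gₙ xⁿ`: its first `n` columns contain the shifted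
coefficients of `f` (the indeterminates `Sum.inl i`) and its last `m` columns contain the
shifted coefficients of `g` (the indeterminates `Sum.inr j`). -/
def sylvesterMatrix (m n : ℕ) :
    Matrix (Fin (m + n)) (Fin (m + n)) (MvPolynomial (Fin (m + 1) ⊕ Fin (n + 1)) ℤ) :=
  Matrix.of fun i j =>
    if (j : ℕ) < n then
      if h : (j : ℕ) ≤ (i : ℕ) ∧ (i : ℕ) - (j : ℕ) ≤ m then
        X (Sum.inl ⟨(i : ℕ) - (j : ℕ), Nat.lt_succ_of_le h.2⟩)
      else 0
    else
      if h : (j : ℕ) - n ≤ (i : ℕ) ∧ (i : ℕ) - ((j : ℕ) - n) ≤ n then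
        X (Sum.inr ⟨(i : ℕ) - ((j : ℕ) - n), Nat.lt_succ_of_le h.2⟩)
      else 0

/-- `genRes m n` is the Sylvester resultant `Res(f,g)` of the generic polynomials
`f` of degree `m` and `g` of degree `n`. -/
def genRes (m n : ℕ) : MvPolynomial (Fin (m + 1) ⊕ Fin (n + 1)) ℤ :=
  (sylvesterMatrix m n).det

/-- The height of an integer multivariate polynomial:
the maximum of the absolute values of its coefficients. -/
def height {σ : Type*} (P : MvPolynomial σ ℤ) : ℕ :=
  P.support.sup fun s => (P.coeff s).natAbs

/-- The absolute value of the coefficient of `e₁ ^ (k - 2 * l) * e₂ ^ l` in the expression of the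
bivariate power sum `x ^ k + y ^ k` in terms of `e₁ = x + y` and `e₂ = x * y`. -/
def lucasCoeff : ℕ → ℕ → ℕ
  | 0, 0 => 2
  | 0, _ + 1 => 0
  | 1, 0 => 1
  | 1, _ + 1 => 0
  | _ + 2, 0 => 1
  | k + 2, l + 1 => lucasCoeff (k + 1) (l + 1) + lucasCoeff k l

theorem lucasCoeff_zero_right {k : ℕ} (hk : 1 ≤ k) : lucasCoeff k 0 = 1 := by
  match k, hk with
  | 1, _ => rfl
  | k + 2, _ => simp [lucasCoeff]

theorem lucasCoeff_eq_zero : ∀ {k l : ℕ}, k < 2 * l → lucasCoeff k l = 0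
  | 0, 0, h => by omega
  | 0, _ + 1, _ => by simp [lucasCoeff]
  | 1, 0, h => by omega
  | 1, _ + 1, _ => by simp [lucasCoeff]
  | _ + 2, 0, h => by omega
  | k + 2, l + 1, h => by
    rw [lucasCoeff, lucasCoeff_eq_zero (by omega), lucasCoeff_eq_zero (by omega)]

theorem lucasCoeff_le_succ {k : ℕ} (hk : 1 ≤ k) (l : ℕ) :
    lucasCoeff k l ≤ lucasCoeff (k + 1) l := by
  match k, hk, l with
  | k + 1, _, 0 => simp [lucasCoeff_zero_right]
  | k + 1, _, l + 1 => simp [lucasCoeff]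

theorem lucasCoeff_le {k n : ℕ} (hk : 1 ≤ k) (hkn : k ≤ n) (l : ℕ) :
    lucasCoeff k l ≤ lucasCoeff n l := by
  induction n, hkn using Nat.le_induction with
  | base => exact le_rfl
  | succ n hn ih => exact ih.trans (lucasCoeff_le_succ (hk.trans hn) l)

theorem lucasCoeff_mul_factorial (l m : ℕ) (h : 1 ≤ 2 * l + m) :
    lucasCoeff (2 * l + m) l * (l.factorial * m.factorial) =
      (2 * l + m) * (l + m - 1).factorial := by
  induction l generalizing m with
  | zero =>
    obtain ⟨m, rfl⟩ : ∃ k, m = k + 1 := ⟨m - 1, by omega⟩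
    simp [lucasCoeff_zero_right, Nat.factorial_succ]
  | succ l ih =>
    induction m with
    | zero =>
      rcases l with _ | l
      · simp [lucasCoeff]
      · have h1 : lucasCoeff (2 * (l + 1 + 1) + 0) (l + 1 + 1) =
          lucasCoeff (2 * (l + 1) + 1) (l + 1 + 1) + lucasCoeff (2 * (l + 1) + 0) (l + 1) := by
          rw [show 2 * (l + 1 + 1) + 0 = 2 * (l + 1) + 2 by ring, lucasCoeff]; rfl
        have h2 := ih 0 (by omega)
        rw [h1, lucasCoeff_eq_zero (by omega), Nat.factorial_succ (l + 1)]
        simp only [Nat.add_sub_cancel, Nat.factorial_zero, add_zero, mul_one, zero_add] at h2 ⊢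
        rw [Nat.factorial_succ l] at h2 ⊢
        linear_combination (l + 1 + 1) * h2
    | succ m ihm =>
      have h1 : lucasCoeff (2 * (l + 1) + (m + 1)) (l + 1) =
          lucasCoeff (2 * (l + 1) + m) (l + 1) + lucasCoeff (2 * l + (m + 1)) l := by
        rw [show 2 * (l + 1) + (m + 1) = 2 * l + m + 1 + 2 by ring, lucasCoeff,
          show 2 * (l + 1) + m = 2 * l + m + 1 + 1 by ring, Nat.add_assoc (2 * l) m 1]
      have h2 := ih (m + 1) (by omega)
      have h3 := ihm (by omega)
      rw [show l + (m + 1) - 1 = l + m by omega] at h2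
      rw [show l + 1 + m - 1 = l + m by omega] at h3
      rw [h1, show l + 1 + (m + 1) - 1 = l + m + 1 by omega, Nat.factorial_succ (l + m)]
      rw [Nat.factorial_succ l] at h3 ⊢
      rw [Nat.factorial_succ m] at h2 ⊢
      linear_combination (m + 1) * h3 + (l + 1) * h2

theorem lucasCoeff_ratio {n l : ℕ} (hn : 1 ≤ n) (hl : 2 * l ≤ n) :
    (lucasCoeff n (l + 1) : ℝ) * ((l + 1) * (n - l - 1)) =
      lucasCoeff n l * ((n - 2 * l) * (n - 2 * l - 1)) := by
  obtain ⟨m, rfl⟩ := Nat.exists_eq_add_of_le hl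
  match m with
  | 0 => rw [lucasCoeff_eq_zero (by omega)]; push_cast; ring
  | 1 => rw [lucasCoeff_eq_zero (by omega)]; push_cast; ring
  | m + 2 =>
    have h1 := lucasCoeff_mul_factorial l (m + 2) (by omega)
    have h2 := lucasCoeff_mul_factorial (l + 1) m (by omega)
    rw [show l + (m + 2) - 1 = l + m + 1 by omega] at h1
    rw [show l + 1 + m - 1 = l + m by omega, show 2 * (l + 1) + m = 2 * l + (m + 2) by ring] at h2
    simp only [Nat.factorial_succ] at h1 h2
    have h1' := congrArg (Nat.cast (R := ℝ)) h1
    have h2' := congrArg (Nat.cast (R := ℝ)) h2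
    push_cast at h1' h2' ⊢
    have hl0 : (l.factorial : ℝ) ≠ 0 := by positivity
    have hm0 : (m.factorial : ℝ) ≠ 0 := by positivity
    refine mul_right_cancel₀ (mul_ne_zero hl0 hm0) ?_
    linear_combination (l + m + 1) * h2' - h1'

theorem pow_add_pow_eq_sum {R : Type*} [CommRing R] (x y : R) (k : ℕ) :
    x ^ k + y ^ k = ∑ l ∈ Finset.range (k + 1),
      (lucasCoeff k l : R) * ((-1) ^ l * (x + y) ^ (k - 2 * l) * (x * y) ^ l) := by
  induction k using Nat.twoStepInduction with
  | zero => simp [lucasCoeff]; norm_num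
  | one => simp [lucasCoeff, Finset.sum_range_succ]
  | more k ih0 ih1 =>
    have e : x ^ (k + 2) + y ^ (k + 2) =
        (x + y) * (x ^ (k + 1) + y ^ (k + 1)) - x * y * (x ^ k + y ^ k) := by ring
    rw [e, ih0, ih1, Finset.sum_range_succ' _ (k + 1 + 1), Finset.sum_range_succ' _ (k + 1),
      Finset.sum_range_succ _ (k + 1), lucasCoeff_eq_zero (show k + 2 < 2 * (k + 1 + 1) by omega),
      lucasCoeff_zero_right (by omega), lucasCoeff_zero_right (by omega), mul_add, Finset.mul_sum,
      Finset.mul_sum]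
    have : ∀ l ∈ Finset.range (k + 1), (lucasCoeff (k + 2) (l + 1) : R) * ((-1) ^ (l + 1) *
        (x + y) ^ (k + 2 - 2 * (l + 1)) * (x * y) ^ (l + 1)) =
        (x + y) * (lucasCoeff (k + 1) (l + 1) * ((-1) ^ (l + 1) *
        (x + y) ^ (k + 1 - 2 * (l + 1)) * (x * y) ^ (l + 1))) - (x * y) *
        (lucasCoeff k l * ((-1) ^ l * (x + y) ^ (k - 2 * l) * (x * y) ^ l)) := by
      intro l _
      rw [lucasCoeff, show k + 2 - 2 * (l + 1) = k - 2 * l by omega]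
      by_cases h : k + 1 < 2 * (l + 1)
      · rw [lucasCoeff_eq_zero h]; push_cast; ring
      · rw [show k - 2 * l = k + 1 - 2 * (l + 1) + 1 by omega]; push_cast; ring
    rw [Finset.sum_congr rfl this, Finset.sum_sub_distrib]
    simp
    ring

open Filter Topology in
theorem tendsto_log_stirlingSeq_sub (c : ℝ) :
    Tendsto (fun k : ℕ => Real.log (Stirling.stirlingSeq k) - 1 / (12 * ((k : ℝ) + c))) atTop
      (𝓝 (Real.log √Real.pi)) := by
  have h1 : Tendsto (fun k : ℕ => Real.log (Stirling.stirlingSeq k)) atTop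
      (𝓝 (Real.log √Real.pi)) :=
    (Real.continuousAt_log (by positivity)).tendsto.comp Stirling.tendsto_stirlingSeq_sqrt_pi
  have h2 : Tendsto (fun k : ℕ => 1 / (12 * ((k : ℝ) + c))) atTop (𝓝 0) := by
    refine Tendsto.div_atTop tendsto_const_nhds ?_
    exact (tendsto_atTop_add_const_right _ c tendsto_natCast_atTop_atTop).const_mul_atTop
      (by norm_num)
  simpa using h1.sub h2

theorem log_stirlingSeq_le {k : ℕ} (hk : 1 ≤ k) :
    Real.log (Stirling.stirlingSeq k) ≤ Real.log √Real.pi + 1 / (12 * k) := by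
  have hmono : Monotone fun j : ℕ =>
      Real.log (Stirling.stirlingSeq (j + 1)) - 1 / (12 * (((j + 1 : ℕ) : ℝ) + 0)) := by
    refine monotone_nat_of_le_succ fun j => ?_
    have h := Stirling.log_stirlingSeq_sdiff_le (j + 1)
    have e : 1 / (12 * ((j + 1 : ℕ) : ℝ) * (((j + 1 : ℕ) : ℝ) + 1)) =
        1 / (12 * (((j + 1 : ℕ) : ℝ) + 0)) - 1 / (12 * (((j + 1 + 1 : ℕ) : ℝ) + 0)) := by
      push_cast; field_simp; ring
    rw [e] at h
    linarith
  have ht := (Filter.tendsto_add_atTop_iff_nat 1).2 (tendsto_log_stirlingSeq_sub 0)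
  obtain ⟨j, rfl⟩ : ∃ j, k = j + 1 := ⟨k - 1, by omega⟩
  have := hmono.ge_of_tendsto ht j
  simp only [add_zero] at this
  linarith

theorem le_log_stirlingSeq {k : ℕ} (hk : 1 ≤ k) :
    Real.log √Real.pi + 1 / (12 * (k + 1)) ≤ Real.log (Stirling.stirlingSeq k) := by
  have hanti : Antitone fun j : ℕ =>
      Real.log (Stirling.stirlingSeq (j + 1)) - 1 / (12 * (((j + 1 : ℕ) : ℝ) + 1)) := by
    refine antitone_nat_of_succ_le fun j => ?_
    have h := (Stirling.log_stirlingSeq_sdiff_hasSum j).summable.le_tsum 0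
      (fun i _ => by positivity)
    rw [(Stirling.log_stirlingSeq_sdiff_hasSum j).tsum_eq] at h
    have e : 1 / (12 * (((j + 1 : ℕ) : ℝ) + 1)) - 1 / (12 * (((j + 1 + 1 : ℕ) : ℝ) + 1)) ≤
        (1 : ℝ) / (2 * ↑(0 + 1) + 1) * ((1 / (2 * ↑(j + 1) + 1)) ^ 2) ^ (0 + 1) := by
      push_cast
      rw [div_sub_div _ _ (by positivity) (by positivity), zero_add, pow_one, div_pow,
        div_mul_div_comm, div_le_div_iff₀ (by positivity) (by positivity)]
      have : (0 : ℝ) ≤ j := by positivity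
      ring_nf
      nlinarith [pow_nonneg this 2]
    have e2 : j + 1 + 1 = j + 2 := rfl
    rw [e2] at *
    linarith
  have ht := (Filter.tendsto_add_atTop_iff_nat 1).2 (tendsto_log_stirlingSeq_sub 1)
  obtain ⟨j, rfl⟩ : ∃ j, k = j + 1 := ⟨k - 1, by omega⟩
  have := hanti.le_of_tendsto ht j
  linarith

theorem log_factorial_eq {k : ℕ} (hk : 1 ≤ k) :
    Real.log k.factorial = Real.log (Stirling.stirlingSeq k) +
      (k * Real.log k - k + (Real.log 2 + Real.log k) / 2) := by
  have hk' : (k : ℝ) ≠ 0 := by positivity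
  rw [Stirling.log_stirlingSeq_formula, Real.log_mul (by norm_num) hk',
    Real.log_div hk' (Real.exp_ne_zero 1), Real.log_exp]
  ring

theorem log_factorial_le {k : ℕ} (hk : 1 ≤ k) :
    Real.log k.factorial ≤ k * Real.log k - k + (Real.log (2 * Real.pi) + Real.log k) / 2 +
      1 / (12 * k) := by
  have h := log_stirlingSeq_le hk
  rw [Real.log_sqrt Real.pi_pos.le] at h
  rw [log_factorial_eq hk, Real.log_mul (by norm_num) Real.pi_ne_zero]
  linarith

theorem le_log_factorial {k : ℕ} (hk : 1 ≤ k) :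
    k * Real.log k - k + (Real.log (2 * Real.pi) + Real.log k) / 2 + 1 / (12 * (k + 1)) ≤
      Real.log k.factorial := by
  have h := le_log_stirlingSeq hk
  rw [Real.log_sqrt Real.pi_pos.le] at h
  rw [log_factorial_eq hk, Real.log_mul (by norm_num) Real.pi_ne_zero]
  linarith

theorem abs_mul_log_one_add_div_sub_le {X z h : ℝ} (hX : 8 ≤ X) (hz : |z| ≤ 4)
    (hh : |h| ≤ 1 / 2) :
    |(X + z + h) * Real.log (1 + z / X) - (z + z ^ 2 / (2 * X) + h * z / X)| ≤ 300 / X ^ 2 := by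
  have hX0 : 0 < X := by linarith
  set t := z / X with ht
  have htz : z = t * X := by rw [ht]; field_simp
  have ht2 : |t| ≤ 4 / X := by rw [ht, abs_div, abs_of_pos hX0]; gcongr
  have ht1 : |t| ≤ 1 / 2 := ht2.trans (by rw [div_le_iff₀ hX0]; linarith)
  have hlog := Real.abs_log_sub_add_sum_range_le (x := -t) (by rw [abs_neg]; linarith) 2
  simp only [Finset.sum_range_succ, Finset.range_zero, Finset.sum_empty, abs_neg] at hlog
  norm_num at hlog
  set e := Real.log (1 + t) - (t - t ^ 2 / 2) with he
  have hle : |e| ≤ 128 / X ^ 3 := by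
    have h1 : |e| ≤ |t| ^ 3 / (1 - |t|) := by
      refine le_trans (le_of_eq ?_) hlog
      rw [he]; congr 1; ring
    refine h1.trans ?_
    rw [div_le_iff₀ (by linarith)]
    have h3 : |t| ^ 3 ≤ (4 / X) ^ 3 := by gcongr
    have h4 : (4 / X) ^ 3 = 128 / X ^ 3 * (1 / 2) := by field_simp; norm_num
    rw [h4] at h3
    refine h3.trans ?_
    gcongr
    linarith
  have key : (X + z + h) * Real.log (1 + t) - (z + z ^ 2 / (2 * X) + h * z / X) =
      -(z ^ 3 / (2 * X ^ 2)) - h * z ^ 2 / (2 * X ^ 2) + (X + z + h) * e := by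
    rw [he, ht]; field_simp; ring
  rw [key]
  have b1 : |z ^ 3 / (2 * X ^ 2)| ≤ 4 ^ 3 / (2 * X ^ 2) := by
    rw [abs_div, abs_pow, abs_of_pos (show 0 < 2 * X ^ 2 by positivity)]; gcongr
  have b2 : |h * z ^ 2 / (2 * X ^ 2)| ≤ 1 / 2 * 4 ^ 2 / (2 * X ^ 2) := by
    rw [abs_div, abs_mul, abs_pow, abs_of_pos (show 0 < 2 * X ^ 2 by positivity)]; gcongr
  have b3 : |(X + z + h) * e| ≤ 2 * X * (128 / X ^ 3) := by
    rw [abs_mul]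
    gcongr
    have := abs_add_three X z h
    rw [abs_of_pos hX0] at this
    linarith
  calc _ ≤ |z ^ 3 / (2 * X ^ 2)| + |h * z ^ 2 / (2 * X ^ 2)| + |(X + z + h) * e| := by
        refine (abs_add_le _ _).trans ?_
        gcongr
        refine (abs_sub _ _).trans ?_
        rw [abs_neg]
    _ ≤ 4 ^ 3 / (2 * X ^ 2) + 1 / 2 * 4 ^ 2 / (2 * X ^ 2) + 2 * X * (128 / X ^ 3) := by gcongr
    _ = 292 / X ^ 2 := by field_simp; norm_num
    _ ≤ 300 / X ^ 2 := by gcongr; norm_num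

theorem log_lucasCoeff {n l : ℕ} (hl : 1 ≤ l) (hln : 2 * l < n) :
    Real.log (lucasCoeff n l) = Real.log n - Real.log (n - l : ℕ) + Real.log (n - l).factorial -
      Real.log l.factorial - Real.log (n - 2 * l).factorial := by
  obtain ⟨m, rfl⟩ := Nat.exists_eq_add_of_le hln.le
  have h := lucasCoeff_mul_factorial l m (by omega)
  have h2 : (l + m) * (l + m - 1).factorial = (l + m).factorial :=
    Nat.mul_factorial_pred (by omega)
  rw [show 2 * l + m - l = l + m by omega, show 2 * l + m - 2 * l = m by omega, ← h2]
  have hpos : 0 < lucasCoeff (2 * l + m) l := by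
    refine Nat.pos_of_ne_zero fun h0 => ?_
    rw [h0, zero_mul] at h
    have := Nat.factorial_pos (l + m - 1)
    have h3 : 0 < (2 * l + m) * (l + m - 1).factorial := by positivity
    omega
  have h' := congrArg (fun x : ℕ => Real.log x) h
  simp only [Nat.cast_mul] at h' ⊢
  have hlm : ((l + m : ℕ) : ℝ) ≠ 0 := by
    have : 0 < l + m := by omega
    positivity
  have hn0 : ((2 * l + m : ℕ) : ℝ) ≠ 0 := by
    have : 0 < 2 * l + m := by omega
    positivity
  have hpos' : (lucasCoeff (2 * l + m) l : ℝ) ≠ 0 := by positivity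
  rw [Real.log_mul hpos' (by positivity), Real.log_mul (by positivity) (by positivity),
    Real.log_mul hn0 (by positivity)] at h'
  rw [Real.log_mul hlm (by positivity)]
  linarith

set_option maxHeartbeats 1000000 in
theorem log_lucasCoeff_asymp {n l : ℕ} (hn : 1000000 ≤ n)
    (hy : |(l : ℝ) - n * ((5 - √5) / 10)| ≤ 2) :
    1 ≤ l ∧ 2 * l < n ∧
    |Real.log (lucasCoeff n l) - (n * Real.log ((1 + √5) / 2) + 3 / 4 * Real.log 5 -
      Real.log 2 / 2 - Real.log n / 2 - Real.log Real.pi / 2) + 20 / n| ≤ 99 / 5 / n := by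
  obtain ⟨s, hs⟩ : ∃ s, s = √5 := ⟨_, rfl⟩
  rw [← hs] at hy ⊢
  have hs2 : s ^ 2 = 5 := by rw [hs]; exact Real.sq_sqrt (by norm_num)
  have hs0 : 0 < s := by rw [hs]; positivity
  have hs_lo : 2.236 < s := by
    rw [hs]; exact Real.lt_sqrt_of_sq_lt (by norm_num)
  have hs_hi : s < 2.2361 := by
    rw [hs, Real.sqrt_lt' (by norm_num)]; norm_num
  have hN : (1000000 : ℝ) ≤ n := by exact_mod_cast hn
  have hN0 : (0 : ℝ) < n := by linarith
  obtain ⟨N, hNdef⟩ : ∃ N : ℝ, (n : ℝ) = N := ⟨_, rfl⟩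
  rw [hNdef] at hy hN hN0 ⊢
  obtain ⟨y, hydef⟩ : ∃ y : ℝ, (l : ℝ) - N * ((5 - s) / 10) = y := ⟨_, rfl⟩
  rw [hydef] at hy
  obtain ⟨hy1, hy2⟩ := abs_le.1 hy
  obtain ⟨A, hA⟩ : ∃ A, A = N * ((5 + s) / 10) := ⟨_, rfl⟩
  obtain ⟨B, hB⟩ : ∃ B, B = N * ((5 - s) / 10) := ⟨_, rfl⟩
  obtain ⟨D, hD⟩ : ∃ D, D = N * (s / 5) := ⟨_, rfl⟩
  have hA1 : 0.72 * N ≤ A := by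
    rw [hA, mul_comm 0.72]; exact mul_le_mul_of_nonneg_left (by linarith) hN0.le
  have hB1 : 0.276 * N ≤ B := by
    rw [hB, mul_comm 0.276]; exact mul_le_mul_of_nonneg_left (by linarith) hN0.le
  have hB2 : B ≤ 0.277 * N := by
    rw [hB, mul_comm 0.277]; exact mul_le_mul_of_nonneg_left (by linarith) hN0.le
  have hD1 : 0.447 * N ≤ D := by
    rw [hD, mul_comm 0.447]; exact mul_le_mul_of_nonneg_left (by linarith) hN0.le
  have hD2 : D ≤ 0.448 * N := by
    rw [hD, mul_comm 0.448]; exact mul_le_mul_of_nonneg_left (by linarith) hN0.le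
  have hb : (l : ℝ) = B + y := by rw [← hydef, hB]; ring
  have hl1 : 1 ≤ l := by
    have : (0 : ℝ) < l := by rw [hb]; linarith
    exact_mod_cast this
  have hl2 : 2 * l < n := by
    have : 2 * (l : ℝ) < n := by rw [hb, hNdef]; linarith
    exact_mod_cast this
  refine ⟨hl1, hl2, ?_⟩
  have ha : ((n - l : ℕ) : ℝ) = A - y := by
    rw [Nat.cast_sub (by omega), hb, hNdef, hA, hB]; ring
  have hc : ((n - 2 * l : ℕ) : ℝ) = D - 2 * y := by
    rw [Nat.cast_sub (by omega)]; push_cast; rw [hb, hNdef, hD, hB]; ring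
  have ua := log_factorial_le (k := n - l) (by omega)
  have la := le_log_factorial (k := n - l) (by omega)
  have ub := log_factorial_le (k := l) (by omega)
  have lb := le_log_factorial (k := l) (by omega)
  have uc := log_factorial_le (k := n - 2 * l) (by omega)
  have lc := le_log_factorial (k := n - 2 * l) (by omega)
  rw [log_lucasCoeff hl1 hl2, hNdef]
  rw [ha] at ua la ⊢
  rw [hb] at ub lb
  rw [hc] at uc lc
  have hαpos : 0 < (1 + s) / 2 := by positivity
  have hA0 : 0 < A := by linarith
  have hB0 : 0 < B := by linarith
  have hD0 : 0 < D := by linarith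
  have l5 : Real.log s = Real.log 5 / 2 := by
    rw [hs, Real.log_sqrt (by norm_num)]
  have logA : Real.log A = Real.log N + Real.log ((1 + s) / 2) - Real.log 5 / 2 := by
    rw [← l5, ← Real.log_mul (by positivity) (by positivity),
      ← Real.log_div (by positivity) (by positivity), hA]
    congr 1; field_simp; linear_combination 2 * hs2
  have logB : Real.log B = Real.log N - Real.log ((1 + s) / 2) - Real.log 5 / 2 := by
    rw [← l5, ← Real.log_div (by positivity) (by positivity),
      ← Real.log_div (by positivity) (by positivity), hB]
    congr 1; field_simp; linear_combination (4 - s) * hs2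
  have logD : Real.log D = Real.log N - Real.log 5 / 2 := by
    rw [← l5, ← Real.log_div (by positivity) (by positivity), hD]
    congr 1; field_simp; linear_combination hs2
  have loga : Real.log (A - y) = Real.log A + Real.log (1 + (-y) / A) := by
    rw [← Real.log_mul (by positivity)]
    · congr 1; field_simp; ring
    · have : 1 + (-y) / A = (A - y) / A := by field_simp; ring
      rw [this]; refine (div_pos ?_ hA0).ne'; linarith
  have logb : Real.log (B + y) = Real.log B + Real.log (1 + y / B) := by
    rw [← Real.log_mul (by positivity)]
    · congr 1; field_simp
    · have : 1 + y / B = (B + y) / B := by field_simp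
      rw [this]; refine (div_pos ?_ hB0).ne'; linarith
  have logc : Real.log (D - 2 * y) = Real.log D + Real.log (1 + (-(2 * y)) / D) := by
    rw [← Real.log_mul (by positivity)]
    · congr 1; field_simp; ring
    · have : 1 + (-(2 * y)) / D = (D - 2 * y) / D := by field_simp; ring
      rw [this]; refine (div_pos ?_ hD0).ne'; linarith
  have ea := abs_mul_log_one_add_div_sub_le (X := A) (z := -y) (h := -(1 / 2)) (by linarith)
    (by rw [abs_neg]; linarith) (by norm_num)
  have eb := abs_mul_log_one_add_div_sub_le (X := B) (z := y) (h := 1 / 2) (by linarith)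
    (by linarith) (by norm_num)
  have ec := abs_mul_log_one_add_div_sub_le (X := D) (z := -(2 * y)) (h := 1 / 2) (by linarith)
    (by rw [abs_neg, abs_mul]; norm_num; linarith) (by norm_num)
  have err : ∀ X, 0.276 * N ≤ X → 300 / X ^ 2 ≤ 0.005 / N := by
    intro X hX
    have hX0 : 0 < X := by linarith
    have h1 : (0.276 * N) ^ 2 ≤ X ^ 2 := by gcongr
    have h2 : 1000000 * N ≤ N ^ 2 := by rw [sq]; gcongr
    rw [div_le_div_iff₀ (by positivity) hN0]
    linarith
  have hsum : (-y + (-y) ^ 2 / (2 * A) + -(1 / 2) * (-y) / A) -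
      (y + y ^ 2 / (2 * B) + 1 / 2 * y / B) -
      (-(2 * y) + (-(2 * y)) ^ 2 / (2 * D) + 1 / 2 * (-(2 * y)) / D) =
      (s / 2 * (y - 5 * y ^ 2)) / N := by
    have iA : 1 / A = (5 - s) / 2 / N := by
      rw [hA]; field_simp; linear_combination hs2
    have iB : 1 / B = (5 + s) / 2 / N := by
      have : 5 - s ≠ 0 := by linarith
      rw [hB]; field_simp; linear_combination hs2
    have iD : 1 / D = s / N := by
      rw [hD]; field_simp; linear_combination -hs2
    linear_combination (y ^ 2 / 2 + y / 2) * iA - (y ^ 2 / 2 + y / 2) * iB + (y - 2 * y ^ 2) * iD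
  have hmain_hi : (s / 2 * (y - 5 * y ^ 2)) / N ≤ 0.06 / N := by
    rw [div_le_div_iff_of_pos_right hN0]
    linarith [mul_nonneg hs0.le (sq_nonneg (y - 1 / 10))]
  have hmain_lo : -30 / N ≤ (s / 2 * (y - 5 * y ^ 2)) / N := by
    rw [div_le_div_iff_of_pos_right hN0]
    have h1 : 5 * y ^ 2 - y ≤ 22 := by
      linarith [mul_nonneg (neg_le_iff_add_nonneg.1 hy1) (sub_nonneg.2 hy2)]
    have h2 : s * (5 * y ^ 2 - y) ≤ s * 22 := mul_le_mul_of_nonneg_left h1 hs0.le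
    linarith
  obtain ⟨ea1, ea2⟩ := abs_le.1 (ea.trans (err A (by linarith)))
  obtain ⟨eb1, eb2⟩ := abs_le.1 (eb.trans (err B (by linarith)))
  obtain ⟨ec1, ec2⟩ := abs_le.1 (ec.trans (err D (by linarith)))
  have ra : 1 / (12 * (A - y)) ≤ 0.117 / N := by
    rw [div_le_div_iff₀ (by linarith) hN0]; linarith
  have rb : 0.3 / N ≤ 1 / (12 * (B + y + 1)) := by
    rw [div_le_div_iff₀ hN0 (by linarith)]; linarith
  have rc : 0.185 / N ≤ 1 / (12 * (D - 2 * y + 1)) := by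
    rw [div_le_div_iff₀ hN0 (by linarith)]; linarith
  have ra' : 0 ≤ 1 / (12 * (A - y + 1)) := by
    refine div_nonneg zero_le_one ?_; linarith
  have rb' : 1 / (12 * (B + y)) ≤ 1 / N := by
    rw [div_le_div_iff₀ (by linarith) hN0]; linarith
  have rc' : 1 / (12 * (D - 2 * y)) ≤ 1 / N := by
    rw [div_le_div_iff₀ (by linarith) hN0]; linarith
  have l2pi : Real.log (2 * Real.pi) = Real.log 2 + Real.log Real.pi :=
    Real.log_mul (by norm_num) Real.pi_ne_zero
  have hABD : A = B + D := by rw [hA, hB, hD]; ring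
  have hABN : A + B = N := by rw [hA, hB]; ring
  have hid : Real.log N - Real.log (A - y) +
      ((A - y) * Real.log (A - y) - (A - y) +
        (Real.log (2 * Real.pi) + Real.log (A - y)) / 2) -
      ((B + y) * Real.log (B + y) - (B + y) +
        (Real.log (2 * Real.pi) + Real.log (B + y)) / 2) -
      ((D - 2 * y) * Real.log (D - 2 * y) - (D - 2 * y) +
        (Real.log (2 * Real.pi) + Real.log (D - 2 * y)) / 2) -
      (N * Real.log ((1 + s) / 2) + 3 / 4 * Real.log 5 -
      Real.log 2 / 2 - Real.log N / 2 - Real.log Real.pi / 2) =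
      (A + -y + -(1 / 2)) * Real.log (1 + (-y) / A) - (B + y + 1 / 2) * Real.log (1 + y / B) -
      (D + -(2 * y) + 1 / 2) * Real.log (1 + (-(2 * y)) / D) := by
    rw [loga, logb, logc, logA, logB, logD, l2pi, ← hABN, hABD]
    ring
  have hdiv : ∀ c : ℝ, c / N = c * N⁻¹ := fun c => div_eq_mul_inv c N
  have inv0 : 0 < N⁻¹ := by positivity
  simp only [hdiv] at hsum hmain_hi hmain_lo ea1 ea2 eb1 eb2 ec1 ec2 ra rb rc ra' rb' rc' ⊢
  rw [abs_le]
  constructor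
  · linarith only [hid, hsum, hmain_lo, ea1, eb2, ec2, la, ub, uc, ra', rb', rc', inv0]
  · linarith only [hid, hsum, hmain_hi, ea2, eb1, ec1, ua, lb, lc, ra, rb, rc, inv0]

theorem sum_sum_range_eq_sum_diagonals {M : Type*} [AddCommMonoid M] (F : ℕ → ℕ → M) (n : ℕ) :
    ∑ i ∈ Finset.range n, ∑ j ∈ Finset.range n, F i j =
      ∑ k ∈ Finset.range n, ∑ i ∈ Finset.range (n - k),
        if k = 0 then F i i else F i (i + k) + F (i + k) i := by
  induction n with
  | zero => simp
  | succ n ih =>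
    have h1 : ∀ k ∈ Finset.range (n + 1), ∑ i ∈ Finset.range (n + 1 - k),
        (if k = 0 then F i i else F i (i + k) + F (i + k) i) =
        ∑ i ∈ Finset.range (n - k), (if k = 0 then F i i else F i (i + k) + F (i + k) i) +
        (if k = 0 then F n n else F (n - k) n + F n (n - k)) := by
      intro k hk
      have hk' : k ≤ n := by simpa [Nat.lt_succ_iff] using hk
      rw [show n + 1 - k = n - k + 1 by omega, Finset.sum_range_succ]
      congr 1
      by_cases h0 : k = 0
      · simp [h0]
      · simp [h0, Nat.sub_add_cancel hk']
    have h3 : ∑ k ∈ Finset.range (n + 1), ∑ i ∈ Finset.range (n - k),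
        (if k = 0 then F i i else F i (i + k) + F (i + k) i) =
        ∑ i ∈ Finset.range n, ∑ j ∈ Finset.range n, F i j := by
      rw [ih, Finset.sum_range_succ, Nat.sub_self, Finset.sum_range_zero, add_zero]
    have h2 : ∑ k ∈ Finset.range n, (if k + 1 = 0 then F n n else
        F (n - (k + 1)) n + F n (n - (k + 1))) = ∑ i ∈ Finset.range n, (F i n + F n i) := by
      rw [← Finset.sum_range_reflect]
      refine Finset.sum_congr rfl fun k hk => ?_
      have hk' := Finset.mem_range.1 hk
      rw [if_neg (Nat.succ_ne_zero _), show n - (n - 1 - k + 1) = k by omega]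
    have h4 : ∑ k ∈ Finset.range (n + 1), (if k = 0 then F n n else
        F (n - k) n + F n (n - k)) = ∑ i ∈ Finset.range n, (F i n + F n i) + F n n := by
      rw [Finset.sum_range_succ', h2, if_pos rfl]
    rw [Finset.sum_congr rfl h1, Finset.sum_add_distrib, h3, h4]
    simp only [Finset.sum_range_succ, Finset.sum_add_distrib]
    abel

theorem resultant_quadratic_eq_of_roots {K : Type*} [Field K] {f g : Polynomial K} {n : ℕ}
    {c a b : K} (hc : c ≠ 0)
    (hf : f = Polynomial.C c *
      ((Polynomial.X - Polynomial.C a) * (Polynomial.X - Polynomial.C b)))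
    (hg : g.natDegree ≤ n) :
    Polynomial.resultant f g 2 n = c ^ n * (g.eval a * g.eval b) := by
  have hsp : f.Splits := by
    rw [hf]
    exact (Polynomial.Splits.C c).mul
      ((Polynomial.Splits.X_sub_C a).mul (Polynomial.Splits.X_sub_C b))
  have hdeg : f.natDegree = 2 := by
    rw [hf, Polynomial.natDegree_C_mul hc,
      Polynomial.natDegree_mul (Polynomial.X_sub_C_ne_zero a) (Polynomial.X_sub_C_ne_zero b)]
    simp
  have hlead : f.leadingCoeff = c := by rw [hf]; simp
  have hroots : f.roots = {a, b} := by
    rw [hf, Polynomial.roots_C_mul _ hc,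
      Polynomial.roots_mul
        (mul_ne_zero (Polynomial.X_sub_C_ne_zero a) (Polynomial.X_sub_C_ne_zero b)),
      Polynomial.roots_X_sub_C, Polynomial.roots_X_sub_C]
    rfl
  have h := Polynomial.resultant_eq_prod_eval f g n hg hsp
  rw [hdeg, hlead, hroots] at h
  simpa using h

theorem resultant_expansion_of_roots {K : Type*} [Field K] {c a b : K} (u : ℕ → K) (n : ℕ)
    (p0 p1 : K) (h0 : p0 = c * (a * b)) (h1 : p1 = -(c * (a + b))) :
    c ^ n * ((∑ i ∈ Finset.range (n + 1), u i * a ^ i) *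
      ∑ i ∈ Finset.range (n + 1), u i * b ^ i) =
    ∑ k ∈ Finset.range (n + 1), ∑ i ∈ Finset.range (n + 1 - k),
      ∑ l ∈ Finset.range (k / 2 + 1),
        (if k = 0 then 1 else (-1) ^ (k - l) * (lucasCoeff k l : K)) *
        (u i * u (i + k) * (p0 ^ (i + l) * p1 ^ (k - 2 * l) * c ^ (n - i - k + l))) := by
  rw [Finset.sum_mul_sum, sum_sum_range_eq_sum_diagonals, Finset.mul_sum]
  refine Finset.sum_congr rfl fun k hk => ?_
  rw [Finset.mul_sum]
  refine Finset.sum_congr rfl fun i hi => ?_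
  have hi' : i + k ≤ n := by
    have := Finset.mem_range.1 hi
    omega
  obtain ⟨m, rfl⟩ := Nat.exists_eq_add_of_le hi'
  rw [show i + k + m - i - k = m by omega]
  by_cases hk0 : k = 0
  · subst hk0
    simp only [if_true, Nat.zero_div, zero_add, Finset.sum_range_one, h0]
    simp
    ring
  · simp only [hk0, if_false]
    have hs := pow_add_pow_eq_sum (c * a) (c * b) k
    have hsub : ∑ l ∈ Finset.range (k + 1),
        (lucasCoeff k l : K) * ((-1) ^ l * (c * a + c * b) ^ (k - 2 * l) * (c * a * (c * b)) ^ l) =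
        ∑ l ∈ Finset.range (k / 2 + 1),
        (lucasCoeff k l : K) *
          ((-1) ^ l * (c * a + c * b) ^ (k - 2 * l) * (c * a * (c * b)) ^ l) := by
      symm
      refine Finset.sum_subset (fun x hx => ?_) fun x _ hx => ?_
      · simp only [Finset.mem_range] at hx ⊢
        omega
      · rw [lucasCoeff_eq_zero, Nat.cast_zero, zero_mul]
        simp only [Finset.mem_range] at hx
        omega
    rw [hsub] at hs
    have e : c ^ (i + k + m) * (u i * a ^ i * (u (i + k) * b ^ (i + k)) +
        u (i + k) * a ^ (i + k) * (u i * b ^ i)) =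
        c ^ (i + m) * u i * u (i + k) * (a * b) ^ i * ((c * a) ^ k + (c * b) ^ k) := by
      ring
    rw [e, hs, Finset.mul_sum]
    refine Finset.sum_congr rfl fun l hl => ?_
    have hl' : 2 * l ≤ k := by
      have := Finset.mem_range.1 hl
      omega
    obtain ⟨r, rfl⟩ := Nat.exists_eq_add_of_le hl'
    rw [show 2 * l + r - 2 * l = r by omega, show 2 * l + r - l = l + r by omega, h0, h1,
      neg_pow (c * (a + b)) r, pow_add (-1 : K) l r]
    have hsq : ((-1 : K) ^ r) * (-1) ^ r = 1 := by rw [← mul_pow]; simp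
    linear_combination (-(lucasCoeff (2 * l + r) l : K) * (-1) ^ l * u i * u (i + (2 * l + r)) *
      (c * (a * b)) ^ (i + l) * (c * (a + b)) ^ r * c ^ (m + l)) * hsq

theorem exists_eq_C_mul_X_sub_C_mul_X_sub_C {K : Type*} [Field K] [IsAlgClosed K] {p0 p1 p2 : K}
    (h2 : p2 ≠ 0) : ∃ a b, p0 = p2 * (a * b) ∧ p1 = -(p2 * (a + b)) := by
  have hdeg := Polynomial.degree_quadratic (b := p1) (c := p0) h2
  obtain ⟨a, ha⟩ := IsAlgClosed.exists_root _ (by rw [hdeg]; simp)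
  simp only [Polynomial.IsRoot.def, Polynomial.eval_add, Polynomial.eval_mul, Polynomial.eval_C,
    Polynomial.eval_pow, Polynomial.eval_X] at ha
  refine ⟨a, -p1 / p2 - a, ?_, ?_⟩
  · field_simp
    linear_combination ha
  · field_simp
    ring

/-- The generic polynomial `f₀ + ⋯ + f_m xᵐ`. -/
def genLeft (m n : ℕ) : Polynomial (MvPolynomial (Fin (m + 1) ⊕ Fin (n + 1)) ℤ) :=
  ∑ i : Fin (m + 1), Polynomial.C (X (Sum.inl i)) * Polynomial.X ^ (i : ℕ)

/-- The generic polynomial `g₀ + ⋯ + gₙ xⁿ`. -/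
def genRight (m n : ℕ) : Polynomial (MvPolynomial (Fin (m + 1) ⊕ Fin (n + 1)) ℤ) :=
  ∑ j : Fin (n + 1), Polynomial.C (X (Sum.inr j)) * Polynomial.X ^ (j : ℕ)

theorem coeff_sum_C_mul_X_pow {R : Type*} [Semiring R] {n : ℕ} (v : Fin (n + 1) → R) {i : ℕ}
    (hi : i ≤ n) : (∑ j : Fin (n + 1), Polynomial.C (v j) * Polynomial.X ^ (j : ℕ)).coeff i =
      v ⟨i, Nat.lt_succ_of_le hi⟩ := by
  rw [Polynomial.finsetSum_coeff, Finset.sum_eq_single ⟨i, Nat.lt_succ_of_le hi⟩]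
  · simp
  · intro j _ hj
    rw [Polynomial.coeff_C_mul_X_pow, if_neg]
    rintro rfl
    exact hj rfl
  · simp

theorem natDegree_genRight_le (m n : ℕ) : (genRight m n).natDegree ≤ n := by
  refine Polynomial.natDegree_sum_le_of_forall_le _ _ fun j _ => ?_
  exact (Polynomial.natDegree_C_mul_X_pow_le _ _).trans (Nat.lt_succ_iff.1 j.2)

theorem genRes_eq_resultant (m n : ℕ) :
    genRes m n = (genRight m n).resultant (genLeft m n) n m := by
  have h : sylvesterMatrix m n = ((genRight m n).sylvester (genLeft m n) n m).submatrix
      (finCongr (add_comm m n)) (finCongr (add_comm m n)) := by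
    ext1 i j
    obtain ⟨j, rfl⟩ := (finCongr (add_comm n m)).surjective j
    induction j using Fin.addCases with
    | left j =>
      simp only [sylvesterMatrix, Polynomial.sylvester, Matrix.of_apply, Matrix.submatrix_apply]
      have : (finCongr (add_comm m n)) ((finCongr (add_comm n m)) (Fin.castAdd m j)) =
        Fin.castAdd m j := by ext; simp
      rw [this, Fin.addCases_left]
      simp only [finCongr_apply, Fin.val_cast, Fin.val_castAdd, Fin.is_lt, if_true, Set.mem_Icc]
      by_cases h : (j : ℕ) ≤ i ∧ (i : ℕ) - j ≤ m
      · rw [dif_pos h, if_pos (by omega), genLeft, coeff_sum_C_mul_X_pow _ h.2]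
      · rw [dif_neg h, if_neg (by omega)]
    | right j =>
      simp only [sylvesterMatrix, Polynomial.sylvester, Matrix.of_apply, Matrix.submatrix_apply]
      have : (finCongr (add_comm m n)) ((finCongr (add_comm n m)) (Fin.natAdd n j)) =
        Fin.natAdd n j := by ext; simp
      rw [this, Fin.addCases_right]
      simp only [finCongr_apply, Fin.val_cast, Fin.val_natAdd, Set.mem_Icc,
        if_neg (show ¬ n + (j : ℕ) < n by omega), Nat.add_sub_cancel_left]
      by_cases h : (j : ℕ) ≤ i ∧ (i : ℕ) - j ≤ n
      · rw [dif_pos h, if_pos (by omega), genRight, coeff_sum_C_mul_X_pow _ h.2]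
      · rw [dif_neg h, if_neg (by omega)]
  rw [genRes, h, Matrix.det_submatrix_equiv_self, Polynomial.resultant]

theorem genRes_two_eq_sum (n : ℕ) :
    genRes 2 n = ∑ k ∈ Finset.range (n + 1), ∑ i ∈ Finset.range (n + 1 - k),
      ∑ l ∈ Finset.range (k / 2 + 1),
        (if k = 0 then 1 else (-1) ^ (k - l) * (lucasCoeff k l : MvPolynomial _ ℤ)) *
        (X (Sum.inr (Fin.ofNat (n + 1) i)) * X (Sum.inr (Fin.ofNat (n + 1) (i + k))) *
        (X (Sum.inl 0) ^ (i + l) * X (Sum.inl 1) ^ (k - 2 * l) *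
          X (Sum.inl 2) ^ (n - i - k + l))) := by
  let R := MvPolynomial (Fin (2 + 1) ⊕ Fin (n + 1)) ℤ
  let K := AlgebraicClosure (FractionRing R)
  let φ : R →+* K := (algebraMap (FractionRing R) K).comp (algebraMap R (FractionRing R))
  have hφ : Function.Injective φ :=
    (algebraMap (FractionRing R) K).injective.comp (IsFractionRing.injective R (FractionRing R))
  have h2 : φ (X (Sum.inl 2)) ≠ 0 := (map_ne_zero_iff φ hφ).2 (X_ne_zero _)
  obtain ⟨a, b, h0, h1⟩ := exists_eq_C_mul_X_sub_C_mul_X_sub_C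
    (p0 := φ (X (Sum.inl 0))) (p1 := φ (X (Sum.inl 1))) h2
  apply hφ
  have hf : (genLeft 2 n).map φ = Polynomial.C (φ (X (Sum.inl 2))) *
      ((Polynomial.X - Polynomial.C a) * (Polynomial.X - Polynomial.C b)) := by
    simp only [genLeft, Polynomial.map_sum, Polynomial.map_mul, Polynomial.map_C,
      Polynomial.map_pow, Polynomial.map_X]
    erw [Fin.sum_univ_three]
    rw [h0, h1]
    simp only [Polynomial.C_mul, Polynomial.C_neg, Polynomial.C_add, Fin.val_zero, Fin.val_one,
      Fin.val_two]
    ring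
  have hg : ∀ x : K, ((genRight 2 n).map φ).eval x = ∑ i ∈ Finset.range (n + 1),
      φ (X (Sum.inr (Fin.ofNat (n + 1) i))) * x ^ i := by
    intro x
    rw [← Fin.sum_univ_eq_sum_range
      (fun i => φ (X (Sum.inr (Fin.ofNat (n + 1) i))) * x ^ i) (n + 1), genRight,
      Polynomial.map_sum, Polynomial.eval_finsetSum]
    refine Finset.sum_congr rfl fun j _ => ?_
    simp
  rw [genRes_eq_resultant, Polynomial.resultant_comm, pow_mul, pow_right_comm, neg_one_sq, one_pow,
    one_mul, ← Polynomial.resultant_map_map, resultant_quadratic_eq_of_roots h2 hf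
      (Polynomial.natDegree_map_le.trans (natDegree_genRight_le 2 n)), hg, hg,
    resultant_expansion_of_roots (fun i => φ (X (Sum.inr (Fin.ofNat (n + 1) i)))) n _ _ h0 h1]
  simp only [map_sum]
  refine Finset.sum_congr rfl fun k _ => Finset.sum_congr rfl fun i _ =>
    Finset.sum_congr rfl fun l _ => ?_
  split_ifs <;> simp

/-- The exponent of the monomial of the quadratic generic resultant indexed by `t = (k, i, l)`. -/
def resExponent (n : ℕ) (t : ℕ × ℕ × ℕ) : Fin (2 + 1) ⊕ Fin (n + 1) →₀ ℕ :=
  Finsupp.single (Sum.inr (Fin.ofNat (n + 1) t.2.1)) 1 +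
    Finsupp.single (Sum.inr (Fin.ofNat (n + 1) (t.2.1 + t.1))) 1 +
    (Finsupp.single (Sum.inl 0) (t.2.1 + t.2.2) + Finsupp.single (Sum.inl 1) (t.1 - 2 * t.2.2) +
      Finsupp.single (Sum.inl 2) (n - t.2.1 - t.1 + t.2.2))

/-- The coefficient of the monomial of the quadratic generic resultant indexed by
`t = (k, i, l)`. -/
def resCoeff (t : ℕ × ℕ × ℕ) : ℤ :=
  if t.1 = 0 then 1 else (-1) ^ (t.1 - t.2.2) * (lucasCoeff t.1 t.2.2 : ℤ)

/-- The triples `(k, i, l)` indexing the monomials of the quadratic generic resultant. -/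
def resIndex (n : ℕ) : Finset (ℕ × ℕ × ℕ) :=
  (Finset.range (n + 1) ×ˢ Finset.range (n + 1) ×ˢ Finset.range (n + 1)).filter
    fun t => t.2.1 + t.1 ≤ n ∧ 2 * t.2.2 ≤ t.1

theorem mem_resIndex {n : ℕ} {t : ℕ × ℕ × ℕ} :
    t ∈ resIndex n ↔ t.2.1 + t.1 ≤ n ∧ 2 * t.2.2 ≤ t.1 := by
  simp only [resIndex, Finset.mem_filter, Finset.mem_product, Finset.mem_range]
  omega

theorem resExponent_injOn (n : ℕ) : Set.InjOn (resExponent n) (resIndex n) := by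
  rintro ⟨k, i, l⟩ ht ⟨k', i', l'⟩ ht' h
  rw [Finset.mem_coe, mem_resIndex] at ht ht'
  dsimp only at ht ht'
  have h0 := DFunLike.congr_fun h (Sum.inl 0)
  have h1 := DFunLike.congr_fun h (Sum.inl 1)
  have hw : ∀ w : ℕ → ℕ, w i + w (i + k) = w i' + w (i' + k') := by
    intro w
    have := congrArg (fun s => s.sum fun x e => e * Sum.elim (fun _ : Fin (2 + 1) => 0)
      (fun j : Fin (n + 1) => w (j : ℕ)) x) h
    simp only [resExponent] at this
    repeat rw [Finsupp.sum_add_index' (by simp) (by intros; ring)] at this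
    simpa [-Finsupp.single_add, -Finsupp.single_tsub, -Finsupp.single_mul,
      Finsupp.sum_single_index, Nat.mod_eq_of_lt (show i < n + 1 by omega),
      Nat.mod_eq_of_lt (show i' < n + 1 by omega), Nat.mod_eq_of_lt (show i + k < n + 1 by omega),
      Nat.mod_eq_of_lt (show i' + k' < n + 1 by omega)] using this
  simp [resExponent] at h0 h1
  have hs := hw id
  have hq := hw fun j => j ^ 2
  simp only [id] at hs
  have hk : k = k' := by
    have hs' : (2 * i + k : ℤ) = 2 * i' + k' := by omega
    have : (k : ℤ) ^ 2 = (k' : ℤ) ^ 2 := by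
      zify at hq
      linear_combination 2 * hq - hs' * (2 * i + k + 2 * i' + k')
    have := (sq_eq_sq₀ (Int.natCast_nonneg k) (Int.natCast_nonneg k')).1 this
    exact_mod_cast this
  subst hk
  have : i = i' := by omega
  have : l = l' := by omega
  subst_vars
  rfl

theorem genRes_two_eq_sum_monomial (n : ℕ) :
    genRes 2 n = ∑ t ∈ resIndex n, monomial (resExponent n t) (resCoeff t) := by
  have h : resIndex n = (Finset.range (n + 1)).biUnion fun k =>
      (Finset.range (n + 1 - k) ×ˢ Finset.range (k / 2 + 1)).map
        ⟨fun p => (k, p), Prod.mk_right_injective k⟩ := by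
    ext ⟨k, i, l⟩
    simp [mem_resIndex]
    omega
  rw [genRes_two_eq_sum, h, Finset.sum_biUnion]
  · refine Finset.sum_congr rfl fun k _ => ?_
    rw [Finset.sum_map, Finset.sum_product]
    refine Finset.sum_congr rfl fun i _ => Finset.sum_congr rfl fun l _ => ?_
    simp only [Function.Embedding.coeFn_mk, resExponent, X_pow_eq_monomial]
    simp only [X, monomial_mul, mul_one]
    rw [← mul_one (resCoeff _), ← C_mul_monomial]
    congr 1
    simp only [resCoeff]
    split_ifs <;> simp
  · intro k _ k' _ hkk'
    rw [Function.onFun, Finset.disjoint_left]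
    rintro ⟨a, p⟩ h1 h2
    simp only [Finset.mem_map, Function.Embedding.coeFn_mk, Prod.mk.injEq] at h1 h2
    obtain ⟨_, _, rfl, _⟩ := h1
    obtain ⟨_, _, rfl, _⟩ := h2
    exact hkk' rfl

theorem natAbs_coeff_le_height {σ : Type*} (P : MvPolynomial σ ℤ) (s : σ →₀ ℕ) :
    (P.coeff s).natAbs ≤ height P := by
  by_cases hs : s ∈ P.support
  · exact Finset.le_sup (f := fun s => (P.coeff s).natAbs) hs
  · simp [notMem_support_iff.1 hs]

theorem coeff_resExponent_genRes {n : ℕ} {t : ℕ × ℕ × ℕ} (ht : t ∈ resIndex n) :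
    (genRes 2 n).coeff (resExponent n t) = resCoeff t := by
  classical
  rw [genRes_two_eq_sum_monomial, coeff_sum, Finset.sum_eq_single_of_mem t ht]
  · simp
  · intro t' ht' hne
    rw [coeff_monomial, if_neg]
    exact fun h => hne (resExponent_injOn n ht' ht h)

theorem natAbs_resCoeff {t : ℕ × ℕ × ℕ} (h : t.1 ≠ 0) :
    (resCoeff t).natAbs = lucasCoeff t.1 t.2.2 := by
  simp [resCoeff, h, Int.natAbs_mul, Int.natAbs_pow]

theorem lucasCoeff_le_height_genRes {n l : ℕ} (hn : 1 ≤ n) (hl : 2 * l ≤ n) :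
    lucasCoeff n l ≤ height (genRes 2 n) := by
  have h := natAbs_coeff_le_height (genRes 2 n) (resExponent n (n, 0, l))
  rwa [coeff_resExponent_genRes (mem_resIndex.2 ⟨by simp, hl⟩),
    natAbs_resCoeff (by simpa using (by omega : n ≠ 0))] at h

theorem height_genRes_le {n B : ℕ} (hn : 1 ≤ n) (hB : ∀ l, 2 * l ≤ n → lucasCoeff n l ≤ B) :
    height (genRes 2 n) ≤ B := by
  classical
  refine Finset.sup_le fun s hs => ?_
  rw [genRes_two_eq_sum_monomial] at hs
  obtain ⟨t, ht, hst⟩ := Finset.mem_biUnion.1 (support_sum hs)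
  obtain rfl := Finset.mem_singleton.1 (support_monomial_subset hst)
  rw [coeff_resExponent_genRes ht]
  have ht' := mem_resIndex.1 ht
  by_cases h : t.1 = 0
  · have := hB 0 (by omega)
    rw [lucasCoeff_zero_right hn] at this
    simpa [resCoeff, h] using this
  · rw [natAbs_resCoeff h]
    exact (lucasCoeff_le (by omega) (by omega) _).trans (hB _ (by omega))

theorem abs_sub_le_of_lucasCoeff_le {n l : ℕ} (hn : 100 ≤ n) (hl : 2 * l ≤ n)
    (hmax : ∀ j, lucasCoeff n j ≤ lucasCoeff n l) :
    |(l : ℝ) - n * ((5 - √5) / 10)| ≤ 2 := by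
  have hpos : (0 : ℝ) < lucasCoeff n l := by
    have := hmax 0
    rw [lucasCoeff_zero_right (by omega)] at this
    exact_mod_cast this
  have hnr : (100 : ℝ) ≤ n := by exact_mod_cast hn
  have hlr : 2 * (l : ℝ) ≤ n := by exact_mod_cast hl
  have hl0 : (0 : ℝ) ≤ l := Nat.cast_nonneg l
  have hs : √5 ^ 2 = 5 := Real.sq_sqrt (by norm_num)
  have hs1 : 2.2 < √5 := Real.lt_sqrt_of_sq_lt (by norm_num)
  have hs2 : √5 < 2.3 := (Real.sqrt_lt' (by norm_num)).2 (by norm_num)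
  have hup : ((n : ℝ) - 2 * l) * (n - 2 * l - 1) ≤ (l + 1) * (n - l - 1) := by
    have h := lucasCoeff_ratio (by omega) hl
    have h' : (lucasCoeff n (l + 1) : ℝ) ≤ lucasCoeff n l := by exact_mod_cast hmax (l + 1)
    have hd : 0 ≤ ((l : ℝ) + 1) * (n - l - 1) := mul_nonneg (by linarith) (by linarith)
    refine le_of_mul_le_mul_left ?_ hpos
    rw [← h]
    exact mul_le_mul_of_nonneg_right h' hd
  have hlpos : 1 ≤ l := by
    by_contra h0
    obtain rfl : l = 0 := by omega
    norm_num at hup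
    nlinarith
  have hlow : (l : ℝ) * (n - l) ≤ (n - 2 * l + 2) * (n - 2 * l + 1) := by
    obtain ⟨j, rfl⟩ := Nat.exists_eq_add_of_le' hlpos
    have h := lucasCoeff_ratio (n := n) (l := j) (by omega) (by omega)
    have h' : (lucasCoeff n j : ℝ) ≤ lucasCoeff n (j + 1) := by exact_mod_cast hmax j
    push_cast at hlr ⊢
    have hd : 0 ≤ ((n : ℝ) - 2 * j) * (n - 2 * j - 1) :=
      mul_nonneg (by linarith) (by linarith)
    refine le_of_mul_le_mul_left ?_ hpos
    have := mul_le_mul_of_nonneg_right h' hd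
    rw [← h] at this
    linarith
  set v : ℝ := l - n * ((5 - √5) / 10) + 2 / 5 with hv
  have hlv : (l : ℝ) = v + n * ((5 - √5) / 10) - 2 / 5 := by rw [hv]; ring
  have hQ : 5 * v ^ 2 - √5 * n * v + 1 / 5 ≤ 0 := by
    rw [hlv] at hup
    linear_combination hup - (n ^ 2 / 20) * hs
  have hQ' : 0 ≤ 5 * (v - 1) ^ 2 - √5 * n * (v - 1) + 1 / 5 := by
    rw [hlv] at hlow
    linear_combination hlow + (n ^ 2 / 20) * hs
  have hvu : v ≤ n * (√5 / 10) + 2 / 5 := by rw [hv]; linarith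
  have hsn : 0 < √5 * n := by positivity
  have hv0 : 0 ≤ v := by
    by_contra! h
    nlinarith [mul_pos hsn (neg_pos.2 h), sq_nonneg v]
  have hv2 : v ≤ 2 := by
    by_contra! h
    nlinarith [mul_pos (by linarith : (0 : ℝ) < v - 1) (by linarith : 0 < v - 2)]
  rw [abs_le]
  constructor <;> linarith

theorem exists_height_genRes_eq {n : ℕ} (hn : 100 ≤ n) :
    ∃ l : ℕ, |(l : ℝ) - n * ((5 - √5) / 10)| ≤ 2 ∧ height (genRes 2 n) = lucasCoeff n l := by
  obtain ⟨l, hl, hmax⟩ := Finset.exists_max_image (Finset.range (n / 2 + 1)) (lucasCoeff n)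
    ⟨0, by simp⟩
  simp only [Finset.mem_range] at hl hmax
  have hl2 : 2 * l ≤ n := by omega
  refine ⟨l, abs_sub_le_of_lucasCoeff_le hn hl2 fun j => ?_, ?_⟩
  · by_cases hj : 2 * j ≤ n
    · exact hmax j (by omega)
    · simp [lucasCoeff_eq_zero (show n < 2 * j by omega)]
  · exact (height_genRes_le (by omega) fun j hj => hmax j (by omega)).antisymm
      (lucasCoeff_le_height_genRes (by omega) hl2)

theorem height_genRes_eq_mul_exp {n : ℕ} (hn : 1000000 ≤ n) :
    ∃ r : ℝ, -40 / n ≤ r ∧ r ≤ -(1 / 5) / n ∧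
      (height (genRes 2 n) : ℝ) = (125 / 4 : ℝ) ^ ((1 : ℝ) / 4) * ((1 + √5) / 2) ^ n /
        √(n * Real.pi) * Real.exp r := by
  obtain ⟨l, hl, hh⟩ := exists_height_genRes_eq (n := n) (by omega)
  obtain ⟨-, hl2, hr⟩ := log_lucasCoeff_asymp hn hl
  have hn0 : (0 : ℝ) < n := by exact_mod_cast (by omega : 0 < n)
  have hpos : (0 : ℝ) < height (genRes 2 n) := by
    have := lucasCoeff_le_height_genRes (n := n) (l := 0) (by omega) (by omega)
    rw [lucasCoeff_zero_right (by omega)] at this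
    exact_mod_cast this
  set M : ℝ := (125 / 4 : ℝ) ^ ((1 : ℝ) / 4) * ((1 + √5) / 2) ^ n / √(n * Real.pi) with hM
  have hα : 0 < (1 + √5) / 2 := by positivity
  have hMpos : 0 < M := by positivity
  have hlog : Real.log M = n * Real.log ((1 + √5) / 2) + 3 / 4 * Real.log 5 - Real.log 2 / 2 -
      Real.log n / 2 - Real.log Real.pi / 2 := by
    rw [hM, Real.log_div (by positivity) (by positivity), Real.log_mul (by positivity)
      (by positivity), Real.log_rpow (by norm_num), Real.log_pow, Real.log_sqrt (by positivity),
      Real.log_mul hn0.ne' Real.pi_ne_zero, show (125 / 4 : ℝ) = 5 ^ 3 / 2 ^ 2 by norm_num,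
      Real.log_div (by norm_num) (by norm_num), Real.log_pow, Real.log_pow]
    push_cast
    ring
  rw [← hh, ← hlog, abs_le] at hr
  refine ⟨Real.log (height (genRes 2 n)) - Real.log M, ?_, ?_, ?_⟩
  · have : -40 / (n : ℝ) ≤ -(99 / 5 / n) - 20 / n := by
      rw [neg_div, ← neg_add', neg_le_neg_iff, ← add_div]
      gcongr
      norm_num
    linarith [hr.1]
  · have : -(1 / 5) / (n : ℝ) = 99 / 5 / n - 20 / n := by ring
    linarith [hr.2]
  · rw [Real.exp_sub, Real.exp_log hpos, Real.exp_log hMpos, mul_div_cancel₀ _ hMpos.ne']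

/-- Let `α = (1+√5)/2` be the positive root of `x²-x-1` and `β = (125/4)^{1/4}` the positive
root of `4x⁴-125`.  With `H(n)` the height of the resultant of a generic quadratic with a
generic degree-`n` polynomial, there are constants `c₁, c₂ > 0` and `N` such that for all
`n > N`: `c₁ αⁿ/n^{3/2} ≤ β αⁿ/√(nπ) - H(n) ≤ c₂ αⁿ/n^{3/2}`. -/
theorem height_quadratic_asymptotics (α β : ℝ)
    (hα : α = (1 + Real.sqrt 5) / 2) (hβ : β = (125 / 4 : ℝ) ^ ((1 : ℝ) / 4)) :
    ∃ c₁ c₂ : ℝ, 0 < c₁ ∧ 0 < c₂ ∧ ∃ N : ℕ, ∀ n : ℕ, N < n →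
      c₁ * α ^ n / (n * Real.sqrt n) ≤
          β * α ^ n / Real.sqrt (n * Real.pi) - (height (genRes 2 n) : ℝ) ∧
        β * α ^ n / Real.sqrt (n * Real.pi) - (height (genRes 2 n) : ℝ) ≤
          c₂ * α ^ n / (n * Real.sqrt n) := by
  have hβ0 : 0 < β := by rw [hβ]; positivity
  have hα0 : 0 < α := by rw [hα]; positivity
  have hπ := Real.pi_pos
  refine ⟨1 / 10 * β / √Real.pi, 40 * β / √Real.pi, by positivity, by positivity, 1000000,
    fun n hn => ?_⟩
  obtain ⟨r, hr1, hr2, hr⟩ := height_genRes_eq_mul_exp hn.le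
  have hn0 : (1000000 : ℝ) < n := by exact_mod_cast hn
  have hn1 : (0 : ℝ) < n := by linarith
  rw [← hα, ← hβ] at hr
  have hM : 0 < β * α ^ n / √(n * Real.pi) := by positivity
  have hc : ∀ c : ℝ, c * β / √Real.pi * α ^ n / (n * √n) =
      β * α ^ n / √(n * Real.pi) * (c / n) := by
    intro c
    rw [Real.sqrt_mul hn1.le]
    field_simp
  have hlow : 1 - 40 / (n : ℝ) ≤ Real.exp r := by
    have h1 := Real.add_one_le_exp r
    rw [neg_div] at hr1
    linarith
  have hup : Real.exp r ≤ 1 - 1 / 10 / (n : ℝ) := by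
    have h1 := Real.add_one_le_exp (-r)
    rw [neg_div] at hr2
    have hq : (0 : ℝ) < 1 / 10 / n := by positivity
    have hq1 : 1 / 10 / (n : ℝ) ≤ 1 / 2 := by
      rw [div_le_iff₀ hn1]
      linarith
    have h2 : 1 + 2 * (1 / 10 / (n : ℝ)) ≤ Real.exp (-r) := by
      have : 1 / 5 / (n : ℝ) = 2 * (1 / 10 / n) := by ring
      linarith
    have h3 : Real.exp r * Real.exp (-r) = 1 := by rw [← Real.exp_add]; simp
    have h4 := Real.exp_pos r
    nlinarith [mul_le_mul_of_nonneg_left h2 h4.le]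
  rw [hc, hc, hr]
  constructor <;> nlinarith
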